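/- Let $G$ be a Lie group, $H\subset G$ a Lie subgroup, $k$ a symmetric ad-invariant $m$-tensor on $\mathfrak{g}$, and $\Omega = k_{i_1\dots i_m}\, d\omega^{i_1}\wedge\cdots\wedge d\omega^{i_{m-1}}\wedge\omega^{i_m}$ the associated closed $(2m-1)$-form. If $k$ vanishes on $\mathcal{H}$ (i.e. $k_{\alpha_1\dots\alpha_m} = 0$ for all indices in $\mathcal{H}$), then the form $\alpha = \sum_{p=1}^m \alpha_m(p)\,\Omega'_{(p)\alpha_1\dots\alpha_{p-1}} F^{\alpha_1}\cdots F^{\alpha_{p-1}}$ with $\alpha_m(p) = \prod_{r=1}^{p-1}\frac{2m-r}{r}$ satisfies the Cartan cocycle condition $d_C\alpha = (d - F^\beta i_\beta)\alpha = 0$. That is, the descent equations $dv_{\alpha_1\dots\alpha_s} = i_{\{\alpha_s}v_{\alpha_1\dots\alpha_{s-1}\}}$ are solved by $v_{\alpha_1\dots\alpha_p} = \big(\prod_{r=1}^p\frac{2m-r}{r}\big)\Omega'_{(p+1)\alpha_1\dots\alpha_p}$, and the only possible obstruction $i_{\{\alpha_m}\Omega'_{(m)\alpha_1\dots\alpha_{m-1}\}}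 = k_{\alpha_1\dots\alpha_m}$ vanishes. -/

import Mathlib

namespace GaugeAux

/-- `Φ ↦ (s ↦ ∑ b, f b * Φ (e b ::ₘ s))`. -/
noncomputable def Sop {I ι R : Type*} [Fintype ι] [Ring R] [Algebra ℝ R] (e : ι → I) (f : ι → R) :
    Module.End ℝ (Multiset I → R) where
  toFun Φ := fun s => ∑ b, f b * Φ (e b ::ₘ s)
  map_add' Φ Ψ := by
    funext s; simp [mul_add, Finset.sum_add_distrib]
  map_smul' c Φ := by
    funext s; simp [Finset.smul_sum]

theorem Sop_apply {I ι R : Type*} [Fintype ι] [Ring R] [Algebra ℝ R] (e : ι → I) (f : ι → R)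
    (Φ : Multiset I → R) (s : Multiset I) : Sop e f Φ s = ∑ b, f b * Φ (e b ::ₘ s) := rfl

theorem Sop_commute {I ι ι' R : Type*} [Fintype ι] [Fintype ι'] [Ring R] [Algebra ℝ R]
    (e : ι → I) (f : ι → R) (e' : ι' → I) (f' : ι' → R) (h : ∀ a b, f a * f' b = f' b * f a) :
    Commute (Sop e f) (Sop e' f') := by
  refine LinearMap.ext fun Φ => funext fun s => ?_
  simp only [Module.End.mul_apply, Sop_apply, Finset.mul_sum]
  rw [Finset.sum_comm]
  refine Finset.sum_congr rfl fun b _ => Finset.sum_congr rfl fun a _ => ?_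
  rw [← mul_assoc, ← mul_assoc, h, Multiset.cons_swap]

theorem Sop_pow_map {I ι R : Type*} [Fintype ι] [Ring R] [Algebra ℝ R]
    (e : ι → I) (f : ι → R) (D : R →ₗ[ℝ] R) (hD : ∀ b y, D (f b * y) = f b * D y)
    (q : ℕ) (Φ : Multiset I → R) (s : Multiset I) :
    D ((Sop e f ^ q) Φ s) = (Sop e f ^ q) (fun t => D (Φ t)) s := by
  induction q generalizing s with
  | zero => simp
  | succ q ih => simp [pow_succ', Module.End.mul_apply, Sop_apply, hD, ih]

theorem Sop_pow_eq_sum {I ι R : Type*} [Fintype ι] [Ring R] [Algebra ℝ R]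
    (e : ι → I) (f : ι → R) (q : ℕ) (Φ : Multiset I → R) (s : Multiset I) :
    (Sop e f ^ q) Φ s = ∑ g : Fin q → ι,
      (List.ofFn fun t => f (g t)).prod *
        Φ (((List.ofFn fun t => e (g t) : List I) : Multiset I) + s) := by
  induction q generalizing s with
  | zero => simp
  | succ q ih =>
    rw [pow_succ', Module.End.mul_apply, Sop_apply]
    rw [← (Fin.consEquiv (fun _ => ι)).sum_comp, Fintype.sum_prod_type]
    refine Finset.sum_congr rfl fun b _ => ?_
    rw [ih, Finset.mul_sum]
    refine Finset.sum_congr rfl fun g _ => ?_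
    simp only [Fin.consEquiv, Equiv.coe_fn_mk, List.ofFn_succ, Fin.cons_zero, Fin.cons_succ,
      List.prod_cons, mul_assoc, ← Multiset.cons_coe, Multiset.add_cons, Multiset.cons_add]

/-- Infinitesimal action of the `l`-th generator. -/
noncomputable def Lsc {I V : Type*} [Fintype I] [DecidableEq I] [AddCommGroup V] [Module ℝ V]
    (C : I → I → I → ℝ) (l : I) (Φ : Multiset I → V) (s : Multiset I) : V :=
  (s.map fun x => ∑ j, C j l x • Φ (j ::ₘ s.erase x)).sum

section
variable {I V V' : Type*} [Fintype I] [DecidableEq I] [AddCommGroup V] [Module ℝ V]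
  [AddCommGroup V'] [Module ℝ V'] (C : I → I → I → ℝ) (l : I)

theorem Lsc_zero (Φ : Multiset I → V) : Lsc C l Φ 0 = 0 := by simp [Lsc]

theorem Lsc_cons (Φ : Multiset I → V) (x : I) (s : Multiset I) :
    Lsc C l Φ (x ::ₘ s) = ∑ j, C j l x • Φ (j ::ₘ s) + Lsc C l (fun t => Φ (x ::ₘ t)) s := by
  simp only [Lsc, Multiset.map_cons, Multiset.sum_cons, Multiset.erase_cons_head]
  congr 2
  refine Multiset.map_congr rfl fun y hy => Finset.sum_congr rfl fun j _ => ?_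
  rw [Multiset.erase_cons_tail_of_mem hy, Multiset.cons_swap]

theorem Lsc_map (D : V →ₗ[ℝ] V') (Φ : Multiset I → V) (s : Multiset I) :
    Lsc C l (fun t => D (Φ t)) s = D (Lsc C l Φ s) := by
  simp [Lsc, map_multiset_sum, Multiset.map_map]

theorem Lsc_sum {ι : Type*} (u : Finset ι) (Φ : ι → Multiset I → V) (s : Multiset I) :
    Lsc C l (fun t => ∑ b ∈ u, Φ b t) s = ∑ b ∈ u, Lsc C l (Φ b) s := by
  simp only [Lsc, Finset.smul_sum]
  rw [Finset.sum, ← Multiset.sum_map_sum_map]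
  refine congrArg _ (Multiset.map_congr rfl fun x _ => ?_)
  exact Finset.sum_comm

theorem Lsc_list (Φ : Multiset I → V) [Inhabited I] (A : List I) :
    ∑ r ∈ Finset.range A.length, ∑ j, C j l (A.getD r default) • Φ ((A.set r j : List I)) =
      Lsc C l Φ (A : Multiset I) := by
  induction A generalizing Φ with
  | nil => simp [Lsc]
  | cons x A ih =>
    rw [← Multiset.cons_coe, Lsc_cons, ← ih, List.length_cons, Finset.sum_range_succ', add_comm]
    simp

end

section
variable {I ι R : Type*} [Fintype I] [DecidableEq I] [Fintype ι] [Ring R] [Algebra ℝ R]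
  (C : I → I → I → ℝ) (l : I) (e : ι → I) (f : ι → R)

/-- the commutator of `Sop` with `Lsc` -/
noncomputable def Nop : Module.End ℝ (Multiset I → R) :=
  Sop id (fun j => ∑ b, C j l (e b) • f b)

theorem Sop_Lsc (Φ : Multiset I → R) :
    Sop e f (Lsc C l Φ) = Nop C l e f Φ + Lsc C l (Sop e f Φ) := by
  funext s
  have h : Lsc C l (Sop e f Φ) s = ∑ b, f b * Lsc C l (fun t => Φ (e b ::ₘ t)) s := by
    change Lsc C l (fun t => ∑ b, f b * Φ (e b ::ₘ t)) s = _
    rw [Lsc_sum]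
    refine Finset.sum_congr rfl fun b _ => ?_
    exact Lsc_map C l (LinearMap.mulLeft ℝ (f b)) _ s
  rw [Pi.add_apply, h]
  simp only [Nop, Sop_apply, Lsc_cons, mul_add, Finset.sum_add_distrib, Finset.mul_sum,
    Finset.sum_mul, id]
  congr 1
  rw [Finset.sum_comm]
  simp

theorem Sop_pow_Lsc (hf : ∀ a b, f a * f b = f b * f a) (n : ℕ) (Φ : Multiset I → R) :
    (Sop e f ^ (n + 1)) (Lsc C l Φ) =
      ((n : ℝ) + 1) • (Sop e f ^ n) (Nop C l e f Φ) + Lsc C l ((Sop e f ^ (n + 1)) Φ) := by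
  have hc : Commute (Sop e f) (Nop C l e f) := by
    apply Sop_commute
    intro a j
    simp only [Finset.mul_sum, Finset.sum_mul]
    exact Finset.sum_congr rfl fun b _ => by simp [hf a b]
  induction n with
  | zero => simp [Sop_Lsc]
  | succ n ih =>
    have h2 := LinearMap.congr_fun (hc.pow_left (n + 1)).eq Φ
    simp only [Module.End.mul_apply] at h2
    rw [pow_succ' (Sop e f) (n + 1), Module.End.mul_apply, ih, map_add, map_smul, Sop_Lsc,
      ← h2, ← Module.End.mul_apply, ← pow_succ', Module.End.mul_apply, ← add_assoc]
    congr 1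
    push_cast
    module

end

theorem ic_pow {I R : Type*} [Fintype I] [Ring R] [Algebra ℝ R]
    (f g : I → R) (D : R →ₗ[ℝ] R) (hD : ∀ b y, D (f b * y) = g b * y + f b * D y)
    (hc : ∀ a b, f a * g b = g b * f a)
    (q : ℕ) (Φ : Multiset I → R) (s : Multiset I) :
    D ((Sop id f ^ q) Φ s) = (Sop id f ^ q) (fun t => D (Φ t)) s
      + (q : ℝ) • Sop id g ((Sop id f ^ (q - 1)) Φ) s := by
  induction q generalizing s with
  | zero => simp
  | succ q ih =>
    have h1 : D ((Sop id f ^ (q + 1)) Φ s) = Sop id g ((Sop id f ^ q) Φ) s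
        + Sop id f (fun t => D ((Sop id f ^ q) Φ t)) s := by
      rw [pow_succ', Module.End.mul_apply]
      simp only [Sop_apply, map_sum, hD, Finset.sum_add_distrib]
    have h2 : (fun t => D ((Sop id f ^ q) Φ t)) = (Sop id f ^ q) (fun t => D (Φ t))
      + (q : ℝ) • Sop id g ((Sop id f ^ (q - 1)) Φ) := by
      funext t; exact ih t
    rw [h1, h2, map_add, map_smul, ← Module.End.mul_apply (Sop id f), ← pow_succ']
    rcases q with _ | q
    · simp [add_comm]
    · have h3 := LinearMap.congr_fun (Sop_commute id f id g hc).eq ((Sop id f ^ q) Φ)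
      simp only [Module.End.mul_apply] at h3
      rw [Nat.add_sub_cancel, h3, ← Module.End.mul_apply (Sop id f), ← pow_succ', Nat.add_sub_cancel]
      simp only [Pi.add_apply, Pi.smul_apply]
      push_cast
      module

theorem sum_cyc {I V : Type*} [Fintype I] [AddCommGroup V] [Module ℝ V]
    (t : I → I → I → ℝ) (w : I → I → I → V) (hw : ∀ a b c, w b c a = w a b c)
    (ht : ∀ a b c, t a b c + t b c a + t c a b = 0) :
    ∑ a, ∑ b, ∑ c, t a b c • w a b c = 0 := by
  have rot : ∀ G : I → I → I → V, ∑ a, ∑ b, ∑ c, G a b c = ∑ a, ∑ b, ∑ c, G b c a := by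
    intro G
    rw [Finset.sum_congr rfl fun a _ => Finset.sum_comm, Finset.sum_comm]
  have h1 : ∑ a, ∑ b, ∑ c, t a b c • w a b c = ∑ a, ∑ b, ∑ c, t b c a • w a b c := by
    rw [rot]; simp only [hw]
  have h2 : ∑ a, ∑ b, ∑ c, t b c a • w a b c = ∑ a, ∑ b, ∑ c, t c a b • w a b c := by
    rw [rot]; simp only [hw]
  have h3 : ∑ a, ∑ b, ∑ c, t a b c • w a b c + ∑ a, ∑ b, ∑ c, t b c a • w a b c
      + ∑ a, ∑ b, ∑ c, t c a b • w a b c = 0 := by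
    simp only [← Finset.sum_add_distrib, ← add_smul, ht, zero_smul, Finset.sum_const_zero]
  rw [← h2, ← h1] at h3
  have h4 : (3 : ℝ) • ∑ a, ∑ b, ∑ c, t a b c • w a b c = 0 := by
    rw [← h3]; module
  exact (smul_eq_zero.1 h4).resolve_left (by norm_num)

end GaugeAux
open GaugeAux

/-- Proposition 4.1: Let `G` be a Lie group, `H ⊂ G` a
subgroup, `k` a symmetric ad-invariant `m`-tensor defining the closed
`(2m-1)`-form `Ω = k_{i₁…i_m} dω^{i₁}∧⋯∧dω^{i_{m-1}}∧ω^{i_m}`.  If `k`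
vanishes on `𝓗`, then
`α = ∑_{p=1}^m α_m(p) Ω'_{(p)α₁…α_{p-1}} F^{α₁}⋯F^{α_{p-1}}`, with
`α_m(p) = ∏_{r=1}^{p-1} (2m-r)/r`, satisfies the Cartan cocycle condition
`d_C α = (d - Fᵝ i_β) α = 0`:  the descent equations are solved by
`v_{α₁…α_p} = (∏_{r=1}^p (2m-r)/r) Ω'_{(p+1)α₁…α_p}` and the only possible
obstruction `i_{{α_m} Ω'_{(m)α₁…α_{m-1}}} = k_{α₁…α_m}` vanishes. -/
theorem gauging_possible_if_polynomial_vanishes_on_subalgebra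
    {ιG : Type*} [Fintype ιG] [DecidableEq ιG] [Inhabited ιG]
    {ιH : Type*} [Fintype ιH] (incl : ιH → ιG)
    (m : ℕ) (hm : 1 ≤ m)
    (C : ιG → ιG → ιG → ℝ)
    (hanti : ∀ a b c, C a b c = - C a c b)
    (hjac : ∀ a b c e,
      ∑ j, (C a j b * C j c e + C a j c * C j e b + C a j e * C j b c) = 0)
    (k : List ιG → ℝ)
    (hksym : ∀ l1 l2 : List ιG, l1.Perm l2 → k l1 = k l2)
    (hinv : ∀ (l : ιG) (xs : List ιG), xs.length = m →
      ∑ r ∈ Finset.range m, ∑ j, C j l (xs.getD r default) * k (xs.set r j) = 0)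
    {Λ : Type*} [Ring Λ] [Algebra ℝ Λ]
    (ω dω : ιG → Λ)
    (hωa : ∀ a b, ω a * ω b = - (ω b * ω a))
    (hdωdef : ∀ a, dω a = - (1/2 : ℝ) • ∑ b, ∑ c, C a b c • (ω b * ω c))
    (d : Λ →ₗ[ℝ] Λ) (ic : ιH → Λ →ₗ[ℝ] Λ)
    (hd_ω : ∀ a, d (ω a) = dω a)
    (hd_dω : ∀ a, d (dω a) = 0)
    (hd_even : ∀ a (y : Λ), d (dω a * y) = dω a * d y)
    (hic_ω : ∀ b a, ic b (ω a) = algebraMap ℝ Λ (if incl b = a then 1 else 0))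
    (hic_dω : ∀ b a, ic b (dω a) = - ∑ l, C a (incl b) l • ω l)
    (hic_even : ∀ b a (y : Λ), ic b (dω a * y) = ic b (dω a) * y + dω a * ic b y)
    (Ωf : (p : ℕ) → (Fin (p - 1) → ιH) → Λ)
    (hΩf : ∀ p (a : Fin (p - 1) → ιH),
      Ωf p a = ∑ g : Fin (m - p) → ιG, ∑ im,
        k ((List.ofFn fun t => incl (a t))
            ++ (List.ofFn fun t : Fin (m - p) => g t) ++ [im])
          • ((List.ofFn fun t : Fin (m - p) => dω (g t)).prod * ω im))
    -- the ambient algebra `𝒮(𝓗*) ⊗ Λ(G)` of the Cartan model: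
    {M : Type*} [Ring M] [Algebra ℝ M]
    (jΛ : Λ →ₗ[ℝ] M) (F : ιH → M)
    (dM : M →ₗ[ℝ] M) (icM : ιH → M →ₗ[ℝ] M)
    (hjd : ∀ x, dM (jΛ x) = jΛ (d x))
    (hji : ∀ b x, icM b (jΛ x) = jΛ (ic b x))
    (hFcentral : ∀ b (x : M), F b * x = x * F b)
    (hdMF : ∀ b (x : M), dM (F b * x) = F b * dM x)
    (hicMF : ∀ a b (x : M), icM a (F b * x) = F b * icM a x)
    -- the equivariant extension `α`:
    (αform : M)
    (hα : αform = ∑ p ∈ Finset.range m,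
      (∏ r ∈ Finset.range p, ((2 * m - (r + 1) : ℝ) / (r + 1))) •
        ∑ a : Fin p → ιH,
          (List.ofFn fun t : Fin p => F (a t)).prod * jΛ (Ωf (p + 1) a))
    -- `k` vanishes on the subalgebra `𝓗`:
    (hk0 : ∀ a : Fin m → ιH, k (List.ofFn fun t => incl (a t)) = 0) :
    dM αform - ∑ b, F b * icM b αform = 0 := by
  classical
  -- commutation facts
  have hωdω : ∀ l a, ω l * dω a = dω a * ω l := by
    intro l a
    rw [hdωdef]
    simp only [Finset.smul_sum, Finset.mul_sum, Finset.sum_mul, mul_smul_comm, smul_mul_assoc]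
    refine Finset.sum_congr rfl fun b _ => Finset.sum_congr rfl fun c _ => ?_
    rw [← mul_assoc, hωa l b, neg_mul, mul_assoc, hωa l c, mul_neg, neg_neg, mul_assoc]
  have hdd : ∀ j, ∑ l, ∑ i, C j l i • (ω l * ω i) = - (2 : ℝ) • dω j := by
    intro j
    rw [hdωdef, smul_smul]; norm_num
  have hjac2 : ∀ j, ∑ l, ∑ x, C j l x • (ω l * dω x) = 0 := by
    intro j
    have e := sum_cyc (fun l b c => ∑ x, C j x l * C x b c) (fun l b c => ω l * (ω b * ω c))
      (fun a b c => by
        rw [← mul_assoc, ← mul_assoc, mul_assoc, hωa c a, mul_neg, ← mul_assoc, hωa b a, neg_mul,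
          neg_neg])
      (fun a b c => by
        rw [← Finset.sum_add_distrib, ← Finset.sum_add_distrib, ← hjac j a b c])
    have e' : ∑ l, ∑ x, C j l x • (ω l * dω x) = (1 / 2 : ℝ) •
        ∑ l, ∑ b, ∑ c, (∑ x, C j x l * C x b c) • (ω l * (ω b * ω c)) := by
      rw [Finset.smul_sum]
      refine Finset.sum_congr rfl fun l _ => ?_
      simp only [Finset.sum_smul, Finset.smul_sum]
      rw [Finset.sum_congr rfl fun b _ => Finset.sum_comm, Finset.sum_comm]
      refine Finset.sum_congr rfl fun x _ => ?_
      rw [hdωdef]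
      simp only [Finset.smul_sum, Finset.mul_sum, mul_smul_comm, smul_smul]
      refine Finset.sum_congr rfl fun b _ => Finset.sum_congr rfl fun c _ => ?_
      rw [hanti j l x]
      congr 1
      ring
    rw [e', e, smul_zero]
  -- the polynomial on multisets
  set k' : Multiset ιG → ℝ := fun s => if Multiset.card s = m then k s.toList else 0 with hk'
  have hk'c : ∀ A : List ιG, A.length = m → k' (A : Multiset ιG) = k A := by
    intro A hA
    simp only [hk', Multiset.coe_card, hA, if_true]
    exact hksym _ _ (Multiset.coe_eq_coe.1 (Multiset.coe_toList _))
  have hinv' : ∀ l s, Lsc C l k' s = 0 := by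
    intro l s
    by_cases hs : Multiset.card s = m
    · induction s using Quotient.inductionOn with
      | _ A =>
      change Lsc C l k' (A : Multiset ιG) = 0
      have hA : A.length = m := hs
      rw [← Lsc_list, hA, ← hinv l A hA]
      refine Finset.sum_congr rfl fun r _ => Finset.sum_congr rfl fun j _ => ?_
      rw [hk'c _ (by simpa using hA), smul_eq_mul]
    · simp only [Lsc]
      refine Multiset.sum_eq_zero fun y hy => ?_
      obtain ⟨x, hx, rfl⟩ := Multiset.mem_map.1 hy
      refine Finset.sum_eq_zero fun j _ => ?_
      have : Multiset.card (j ::ₘ s.erase x) = Multiset.card s := by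
        rw [Multiset.card_cons, Multiset.card_erase_add_one hx]
      simp only [hk', this, if_neg hs, smul_zero]
  set κ : Multiset ιG → Λ := fun s => algebraMap ℝ Λ (k' s) with hκ
  set K1 : Multiset ιG → Λ := fun s => ∑ i, k' (i ::ₘ s) • ω i with hK1
  set S : Module.End ℝ (Multiset ιG → Λ) := Sop id dω with hS
  set T : Module.End ℝ (Multiset ιG → M) := Sop incl F with hT
  -- exterior derivative
  have hdK : ∀ q s, d ((S ^ q) K1 s) = (S ^ (q + 1)) κ s := by
    intro q s
    rw [hS, Sop_pow_map id dω d hd_even, pow_succ, Module.End.mul_apply]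
    refine congrFun (congrArg _ (funext fun t => ?_)) s
    simp only [hK1, hκ, Sop_apply, hd_ω, map_sum, map_smul, id]
    exact Finset.sum_congr rfl fun i _ => by rw [Algebra.smul_def, Algebra.commutes]
  -- contraction
  have hiK : ∀ (b : ιH) (q : ℕ) (s : Multiset ιG), ic b ((S ^ q) K1 s) = (S ^ q) κ (incl b ::ₘ s) +
      (q : ℝ) • Sop id (fun j => ic b (dω j)) ((S ^ (q - 1)) K1) s := by
    intro b q s
    rw [hS, ic_pow dω (fun j => ic b (dω j)) (ic b) (hic_even b)]
    · congr 1
      rw [Sop_pow_eq_sum, Sop_pow_eq_sum]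
      refine Finset.sum_congr rfl fun g _ => ?_
      congr 1
      rw [Multiset.add_cons]
      simp only [hK1, hκ, hic_ω, map_sum, map_smul]
      rw [Finset.sum_eq_single (incl b)]
      · simp [Algebra.smul_def]
      · intro i _ hi
        simp [hi.symm]
      · simp
    · intro a c
      simp only [hic_dω, mul_neg, neg_mul, Finset.mul_sum, Finset.sum_mul, mul_smul_comm,
        smul_mul_assoc, hωdω]
  -- the invariance identity
  have hL1 : ∀ s, ∑ l, ω l * Lsc C l K1 s = (2 : ℝ) • S κ s := by
    intro s
    have e1 : ∀ l, Lsc C l K1 s = ∑ i, Lsc C l (fun t => k' (i ::ₘ t)) s • ω i := by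
      intro l
      rw [hK1, Lsc_sum]
      refine Finset.sum_congr rfl fun i _ => ?_
      exact Lsc_map C l (LinearMap.toSpanSingleton ℝ Λ (ω i)) _ s
    have e2 : ∀ l i, Lsc C l (fun t => k' (i ::ₘ t)) s = - ∑ j, C j l i • k' (j ::ₘ s) := by
      intro l i
      have := hinv' l (i ::ₘ s)
      rw [Lsc_cons] at this
      linarith
    have e3 : ∀ j, (k' (j ::ₘ s)) • ((2 : ℝ) • dω j) = 
        ∑ l, ∑ i, -((C j l i * k' (j ::ₘ s)) • (ω l * ω i)) := by
      intro j
      rw [← neg_neg ((2 : ℝ) • dω j), ← neg_smul, ← hdd, smul_neg, Finset.smul_sum]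
      simp only [Finset.smul_sum, smul_smul, Finset.sum_neg_distrib, mul_comm]
    have e4 : (2 : ℝ) • S κ s = ∑ j, (k' (j ::ₘ s)) • ((2 : ℝ) • dω j) := by
      rw [hS, Sop_apply, Finset.smul_sum]
      refine Finset.sum_congr rfl fun j _ => ?_
      rw [hκ, smul_comm, Algebra.smul_def (k' _), Algebra.commutes, id]
    rw [e4]
    simp only [e3, e1, e2, Finset.mul_sum, neg_smul, Finset.sum_smul, mul_neg, mul_smul_comm,
      smul_eq_mul, Finset.sum_neg_distrib]
    congr 1
    rw [Finset.sum_congr rfl fun l _ => Finset.sum_comm, Finset.sum_comm]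
  have hNz : ∀ Φ : Multiset ιG → Λ, ∀ s, ∑ l, ω l * Nop C l id dω Φ s = 0 := by
    intro Φ s
    have : ∑ l, ω l * Nop C l id dω Φ s =
        ∑ j, (∑ l, ∑ x, C j l x • (ω l * dω x)) * Φ (j ::ₘ s) := by
      simp only [Nop, Sop_apply, Finset.mul_sum, Finset.sum_mul, id]
      rw [Finset.sum_comm]
      simp [mul_assoc]
    rw [this]
    simp [hjac2]
  have hLq : ∀ q s, ∑ l, ω l * Lsc C l ((S ^ q) K1) s = (2 : ℝ) • (S ^ (q + 1)) κ s := by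
    intro q
    induction q with
    | zero => simpa using hL1
    | succ q ih =>
      intro s
      have e : ∀ l, Lsc C l ((S ^ (q + 1)) K1) s =
          S (Lsc C l ((S ^ q) K1)) s - Nop C l id dω ((S ^ q) K1) s := by
        intro l
        rw [hS, Sop_Lsc, pow_succ', Module.End.mul_apply]; simp
      simp only [e, mul_sub, Finset.sum_sub_distrib, hNz, sub_zero]
      rw [pow_succ', Module.End.mul_apply, hS, Sop_apply, Finset.smul_sum]
      simp only [Sop_apply, Finset.mul_sum]
      rw [Finset.sum_comm]
      refine Finset.sum_congr rfl fun x _ => ?_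
      rw [← hS, ← mul_smul_comm, ← ih, Finset.mul_sum]
      refine Finset.sum_congr rfl fun l _ => ?_
      rw [← mul_assoc, ← mul_assoc, hωdω]
  -- the Cartan level
  set X : ℕ → M := fun p => (T ^ p) (fun s => jΛ ((S ^ (m - p)) κ s)) 0 with hX
  set Y : ℕ → M := fun p => (T ^ p) (fun s => jΛ ((S ^ (m - (p + 1))) K1 s)) 0 with hY
  have hFF : ∀ a b, F a * F b = F b * F a := fun a b => hFcentral a (F b)
  have hαY : αform = ∑ p ∈ Finset.range m,
      (∏ r ∈ Finset.range p, ((2 * m - (r + 1) : ℝ) / (r + 1))) • Y p := by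
    rw [hα]
    refine Finset.sum_congr rfl fun p hp => ?_
    have hp' := Finset.mem_range.1 hp
    congr 1
    rw [hY, hT]
    simp only []
    rw [Sop_pow_eq_sum]
    refine Finset.sum_congr rfl fun a _ => ?_
    congr 2
    rw [hΩf, hS, Sop_pow_eq_sum]
    refine Finset.sum_congr rfl fun g _ => ?_
    rw [hK1, Finset.mul_sum]
    refine Finset.sum_congr rfl fun i _ => ?_
    rw [mul_smul_comm]
    congr 1
    rw [← hk'c]
    · congr 1
      simp only [← Multiset.coe_add, add_zero, id]
      rw [← Multiset.singleton_add, Multiset.coe_singleton]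
      change _ = _ + (_ + ((List.ofFn fun t : Fin (p + 1 - 1) => incl (a t) : List ιG) :
        Multiset ιG))
      abel
    · simp
      omega
  have hdY : ∀ p, p < m → dM (Y p) = X p := by
    intro p hp
    rw [hY, hX, hT]
    simp only []
    rw [Sop_pow_map incl F dM hdMF]
    simp only [hjd, hdK]
    rw [show m - (p + 1) + 1 = m - p by omega]
  have hiY : ∀ p, p < m →
      ∑ b, F b * icM b (Y p) = ((2 * m - (p + 1) : ℝ) / (p + 1)) • X (p + 1) := by
    intro p hp
    have e1 : ∑ b, F b * icM b (Y p) =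
        (T ^ p) (fun s => ∑ b, F b * jΛ (ic b ((S ^ (m - (p + 1))) K1 s))) 0 := by
      have : ∀ b, F b * icM b (Y p) =
          (T ^ p) (fun s => F b * jΛ (ic b ((S ^ (m - (p + 1))) K1 s))) 0 := by
        intro b
        rw [hY, hT]
        simp only []
        rw [Sop_pow_map incl F (icM b) (fun a x => hicMF b a x)]
        have := Sop_pow_map incl F (LinearMap.mulLeft ℝ (F b)) (fun a y => by
          simp only [LinearMap.mulLeft_apply, ← mul_assoc, hFF]) p
          (fun s => jΛ (ic b ((S ^ (m - (p + 1))) K1 s))) 0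
        simp only [LinearMap.mulLeft_apply] at this
        simp only [hji, this]
      rw [Finset.sum_congr rfl fun b _ => this b, ← Finset.sum_apply, ← map_sum]
      refine congrFun (congrArg _ (funext fun s => ?_)) 0
      simp
    obtain ⟨q, hq⟩ : ∃ q, q = m - (p + 1) := ⟨_, rfl⟩
    have e2 : (fun s => ∑ b, F b * jΛ (ic b ((S ^ q) K1 s))) =
        T (fun s => jΛ ((S ^ q) κ s)) +
        (q : ℝ) • ∑ l, Nop C l incl F (fun s => jΛ (ω l * (S ^ (q - 1)) K1 s)) := by
      funext s
      simp only [hiK, map_add, mul_add, Finset.sum_add_distrib, map_smul, mul_smul_comm,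
        ← Finset.smul_sum, Pi.add_apply, Pi.smul_apply, Finset.sum_apply]
      congr 2
      simp only [Nop, Sop_apply, map_sum, hic_dω, Finset.mul_sum, Finset.sum_mul, id,
        smul_mul_assoc, ← Finset.sum_neg_distrib, ← smul_neg, map_smul,
        mul_smul_comm]
      rw [Finset.sum_congr rfl fun b _ => Finset.sum_comm, Finset.sum_comm]
      refine Finset.sum_congr rfl fun l _ => ?_
      rw [Finset.sum_comm]
      refine Finset.sum_congr rfl fun y _ => Finset.sum_congr rfl fun x _ => ?_
      rw [hanti y l, neg_mul, map_neg, mul_neg, smul_neg, neg_smul]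
    have e3 : X (p + 1) = (T ^ p) (T (fun s => jΛ ((S ^ q) κ s))) 0 := by
      rw [← Module.End.mul_apply, ← pow_succ, hq]
    rw [e1, ← hq, e2, map_add, Pi.add_apply, ← e3, map_smul, map_sum, Pi.smul_apply,
      Finset.sum_apply]
    have hqm : (m : ℝ) = q + p + 1 := by
      have : m = q + p + 1 := by omega
      rw [this]; push_cast; ring
    have hp0 : (p : ℝ) + 1 ≠ 0 := by positivity
    rcases q with _ | q
    · rw [hqm]
      push_cast
      rw [show (2 * (0 + (p : ℝ) + 1) - (p + 1)) / (p + 1) = 1 by field_simp; ring]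
      simp
    · have e4 : ((p : ℝ) + 1) • ∑ l, (T ^ p)
          (Nop C l incl F (fun s => jΛ (ω l * (S ^ q) K1 s))) 0 = (2 : ℝ) • X (p + 1) := by
        have e5 : ∀ l, ((p : ℝ) + 1) • (T ^ p)
            (Nop C l incl F (fun s => jΛ (ω l * (S ^ q) K1 s))) 0 =
            (T ^ (p + 1)) (Lsc C l (fun s => jΛ (ω l * (S ^ q) K1 s))) 0 := by
          intro l
          rw [hT, Sop_pow_Lsc C l incl F hFF, Pi.add_apply, Lsc_zero, add_zero, Pi.smul_apply]
        rw [Finset.smul_sum, Finset.sum_congr rfl fun l _ => e5 l, ← Finset.sum_apply, ← map_sum]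
        have e6 : ∑ l, Lsc C l (fun s => jΛ (ω l * (S ^ q) K1 s)) =
            (2 : ℝ) • fun s => jΛ ((S ^ (q + 1)) κ s) := by
          funext s
          rw [Finset.sum_apply, Pi.smul_apply, ← map_smul, ← hLq, map_sum]
          refine Finset.sum_congr rfl fun l _ => ?_
          exact Lsc_map C l (jΛ ∘ₗ LinearMap.mulLeft ℝ (ω l)) _ s
        rw [e6, map_smul, Pi.smul_apply, e3, ← Module.End.mul_apply, ← pow_succ]
      rw [Nat.add_sub_cancel]
      have e7 : ∑ l, (T ^ p) (Nop C l incl F (fun s => jΛ (ω l * (S ^ q) K1 s))) 0 =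
          (2 / ((p : ℝ) + 1)) • X (p + 1) := by
        rw [div_eq_inv_mul, mul_smul, ← e4, smul_smul, inv_mul_cancel₀ hp0, one_smul]
      rw [e7, hqm, smul_smul, ← one_smul ℝ (X (p + 1)), smul_smul, smul_smul, ← add_smul]
      congr 1
      push_cast
      field_simp
      ring
  have hX0 : X 0 = 0 := by
    have := hLq (m - 1) 0
    simp only [Lsc_zero, mul_zero, Finset.sum_const_zero] at this
    rw [show m - 1 + 1 = m by omega] at this
    have h2 : (S ^ m) κ 0 = 0 := (smul_eq_zero.1 this.symm).resolve_left (by norm_num)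
    simp [hX, h2]
  have hXm : X m = 0 := by
    rw [hX, hT]
    simp only []
    rw [Sop_pow_eq_sum]
    refine Finset.sum_eq_zero fun a _ => ?_
    rw [Nat.sub_self, pow_zero, Module.End.one_apply, add_zero]
    simp only [hκ]
    rw [hk'c _ (by simp), hk0]
    simp
  set c : ℕ → ℝ := fun p => ∏ r ∈ Finset.range p, ((2 * m - (r + 1) : ℝ) / (r + 1)) with hc
  have h1 : dM αform = ∑ p ∈ Finset.range m, c p • X p := by
    rw [hαY, map_sum]
    refine Finset.sum_congr rfl fun p hp => ?_
    rw [map_smul, hdY p (Finset.mem_range.1 hp)]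
  have h2 : ∑ b, F b * icM b αform = ∑ p ∈ Finset.range m, c (p + 1) • X (p + 1) := by
    rw [hαY]
    simp only [map_sum, map_smul, Finset.mul_sum, mul_smul_comm]
    rw [Finset.sum_comm]
    refine Finset.sum_congr rfl fun p hp => ?_
    rw [← Finset.smul_sum, hiY p (Finset.mem_range.1 hp), smul_smul]
    simp only [hc, Finset.prod_range_succ]
  rw [h1, h2, ← Finset.sum_sub_distrib, Finset.sum_range_sub', hX0, hXm]
  simp
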